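/- For k ≥ 2, the number of (k,n)-de Bruijn sequences (cyclic sequences of length k^n over alphabet {0,...,k-1} containing every word of length n exactly once as a cyclic factor) equals (k!)^(k^(n-1)) / k^n. -/

import Mathlib

/-- `w : ZMod (k^n) → Fin k` is a `(k,n)`-de Bruijn sequence if every word of
length `n` over `Fin k` appears exactly once as a cyclic factor, i.e. the
window map is a bijection. -/
def IsDeBruijnSeq (k n : ℕ) (w : ZMod (k ^ n) → Fin k) : Prop :=
  Function.Bijective (fun (i : ZMod (k ^ n)) (t : Fin n) => w (i + (t : ℕ)))


open Equiv

/-- Averaging an alternating map over the permutations of one block. -/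
theorem one_block {V K X : Type} [Fintype V] [DecidableEq V] [Fintype K] [DecidableEq K]
    [Nonempty K] [AddCommGroup X] [Module ℚ X] (f : X [⋀^(V × K)]→ₗ[ℚ] ℚ)
    (M : V × K → X) (v : V) (b : K → X) :
    ∑ τ : Perm K, f (M + fun p : V × K => if p.1 = v then b (τ p.2) else 0)
      = (Nat.factorial (Fintype.card K) : ℚ) *
        f (M + fun p : V × K => if p.1 = v then (Fintype.card K : ℚ)⁻¹ • ∑ c, b c else 0) := by
  have key : ∀ Y : V × K → X, f (M + Y) =
      ∑ s : Finset (V × K), f (s.piecewise M Y) := by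
    intro Y
    exact MultilinearMap.map_add_univ f.toMultilinearMap M Y
  simp_rw [key]
  rw [Finset.sum_comm, Finset.mul_sum]
  refine Finset.sum_congr rfl fun s _ => ?_
  by_cases h1 : ∃ p, p ∉ s ∧ p.1 ≠ v
  · obtain ⟨p, hp, hv⟩ := h1
    have z : ∀ g : K → X, f (s.piecewise M
        (fun p : V × K => if p.1 = v then g p.2 else 0)) = 0 := by
      intro g
      apply AlternatingMap.map_coord_zero _ p
      rw [Finset.piecewise_eq_of_notMem _ _ _ hp]
      simp [hv]
    have z1 := fun τ : Perm K => z (fun a => b (τ a))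
    have z2 := z (fun _ => (Fintype.card K : ℚ)⁻¹ • ∑ c, b c)
    rw [z2, mul_zero]
    exact Finset.sum_eq_zero fun τ _ => z1 τ
  push Not at h1
  by_cases h2 : ∃ a c, a ≠ c ∧ (v, a) ∉ s ∧ (v, c) ∉ s
  · obtain ⟨a, c, hac, ha, hc⟩ := h2
    have hne : (v, a) ≠ (v, c) := by simpa using hac
    have z2 : f (s.piecewise M
        (fun p : V × K => if p.1 = v then (Fintype.card K : ℚ)⁻¹ • ∑ c, b c else 0)) = 0 := by
      refine AlternatingMap.map_eq_zero_of_eq _ _ ?_ hne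
      rw [Finset.piecewise_eq_of_notMem _ _ _ ha, Finset.piecewise_eq_of_notMem _ _ _ hc]
    rw [z2, mul_zero]
    have hs : ∑ τ : Perm K, f (s.piecewise M
        (fun p : V × K => if p.1 = v then b (τ p.2) else 0)) =
        - ∑ τ : Perm K, f (s.piecewise M
        (fun p : V × K => if p.1 = v then b (τ p.2) else 0)) := by
      conv_lhs => rw [← Equiv.sum_comp (Equiv.mulRight (swap a c))]
      rw [← Finset.sum_neg_distrib]
      refine Finset.sum_congr rfl fun τ _ => ?_
      rw [← AlternatingMap.map_swap _ _ hne]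
      congr 1
      funext p
      by_cases hpa : p = (v, a)
      · subst hpa
        simp [Finset.piecewise, ha, hc]
      by_cases hpc : p = (v, c)
      · subst hpc
        simp [Finset.piecewise, ha, hc]
      · rw [Function.comp_apply, swap_apply_of_ne_of_ne hpa hpc]
        by_cases hp : p ∈ s
        · simp [Finset.piecewise, hp]
        · have hv := h1 p hp
          have e1 : p.2 ≠ a := fun h => hpa (Prod.ext hv h)
          have e2 : p.2 ≠ c := fun h => hpc (Prod.ext hv h)
          simp [Finset.piecewise, hp, hv, swap_apply_of_ne_of_ne e1 e2]
    linarith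
  push Not at h2
  by_cases h3 : ∃ a, (v, a) ∉ s
  · obtain ⟨a, ha⟩ := h3
    have hpw : ∀ g : K → X, s.piecewise M
        (fun p : V × K => if p.1 = v then g p.2 else 0) =
        Function.update M (v, a) (g a) := by
      intro g
      funext p
      by_cases hp : p = (v, a)
      · subst hp; simp [Finset.piecewise, ha]
      · have : p ∈ s := by
          by_contra hps
          have hv := h1 p hps
          have hpe : (v, p.2) = p := Prod.ext hv.symm rfl
          have : a ≠ p.2 := fun h => hp (by rw [← hpe, h])
          exact hps (hpe ▸ h2 a p.2 this ha)
        simp [Finset.piecewise, this, hp]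
    have r1 := fun τ : Perm K => hpw (fun a => b (τ a))
    have r2 := hpw (fun _ => (Fintype.card K : ℚ)⁻¹ • ∑ c, b c)
    simp_rw [r1, r2]
    set L : X →ₗ[ℚ] ℚ := f.toMultilinearMap.toLinearMap M (v, a) with hL
    change ∑ τ : Perm K, L (b (τ a)) = _ * L _
    rw [map_smul, map_sum, smul_eq_mul]
    have hconst : ∀ a', ∑ τ : Perm K, L (b (τ a')) = ∑ τ : Perm K, L (b (τ a)) := by
      intro a'
      rw [← Equiv.sum_comp (Equiv.mulRight (swap a a'))]
      simp
    have h4 : ∑ a', ∑ τ : Perm K, L (b (τ a')) = Fintype.card K * ∑ τ : Perm K, L (b (τ a)) := by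
      simp_rw [hconst]; simp
    rw [Finset.sum_comm] at h4
    have h5 : ∀ τ : Perm K, ∑ a', L (b (τ a')) = ∑ c, L (b c) := fun τ =>
      Equiv.sum_comp τ (fun c => L (b c))
    simp_rw [h5] at h4
    rw [Finset.sum_const, Finset.card_univ, Fintype.card_perm, nsmul_eq_mul] at h4
    have hK : (Fintype.card K : ℚ) ≠ 0 := by simp
    field_simp
    linarith
  · push Not at h3
    have hs : s = Finset.univ := by
      ext p
      simp only [Finset.mem_univ, iff_true]
      by_contra hp
      have h := h3 p.2
      rw [← h1 p hp] at h
      exact hp h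
    subst hs
    simp [Fintype.card_perm]

/-- Averaging an alternating map over independent permutations of all blocks. -/
theorem all_blocks {V K X : Type} [Fintype V] [DecidableEq V] [Fintype K] [DecidableEq K]
    [Nonempty K] [AddCommGroup X] [Module ℚ X] (f : X [⋀^(V × K)]→ₗ[ℚ] ℚ)
    (A : V × K → X) (B : V → K → X) :
    ∑ π : V → Perm K, f (fun p => A p + B p.1 (π p.1 p.2))
      = (Nat.factorial (Fintype.card K) : ℚ) ^ (Fintype.card V) *
        f (fun p => A p + (Fintype.card K : ℚ)⁻¹ • ∑ c, B p.1 c) := by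
  let G : Finset V → (V → Perm K) → ℚ := fun s π => f (fun p => A p +
    if p.1 ∈ s then (Fintype.card K : ℚ)⁻¹ • ∑ c, B p.1 c else B p.1 (π p.1 p.2))
  have hG : ∀ s π, G s π = f (fun p => A p +
    if p.1 ∈ s then (Fintype.card K : ℚ)⁻¹ • ∑ c, B p.1 c else B p.1 (π p.1 p.2)) := fun _ _ => rfl
  clear_value G
  have step : ∀ s : Finset V, ∑ π : V → Perm K, G s π = ∑ π : V → Perm K, G ∅ π := by
    intro s
    induction s using Finset.induction_on with
    | empty => rfl
    | insert v s hv ih =>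
      rw [← ih]
      have hF : (Nat.factorial (Fintype.card K) : ℚ) ≠ 0 := by
        exact_mod_cast Nat.factorial_ne_zero _
      apply mul_left_cancel₀ hF
      have e1 : ∀ τ : Perm K, ∑ π : V → Perm K, G s (π * (Pi.mulSingle v τ : V → Perm K)) = ∑ π : V → Perm K, G s π := fun τ =>
        Equiv.sum_comp (Equiv.mulRight (Pi.mulSingle v τ : V → Perm K)) (G s)
      have e2 : ∑ τ : Perm K, ∑ π : V → Perm K, G s (π * (Pi.mulSingle v τ : V → Perm K)) =
          (Nat.factorial (Fintype.card K) : ℚ) * ∑ π : V → Perm K, G s π := by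
        simp_rw [e1]
        simp [Fintype.card_perm]
      rw [← e2, Finset.sum_comm, Finset.mul_sum]
      refine Finset.sum_congr rfl fun π _ => ?_
      have ob := one_block f (fun p => A p + if p.1 = v then 0 else if p.1 ∈ s then
        (Fintype.card K : ℚ)⁻¹ • ∑ c, B p.1 c else B p.1 (π p.1 p.2)) v (fun c => B v (π v c))
      simp only [hG]
      refine Eq.trans ?_ (ob.symm.trans ?_)
      · congr 2
        funext p
        by_cases h : p.1 = v
        · simp [h, Equiv.sum_comp (π v) (B v)]
        · simp [h]
      · refine Finset.sum_congr rfl fun τ _ => ?_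
        congr 1
        funext p
        by_cases h : p.1 = v
        · simp [h, hv]
        · simp [h]
  have h1 := step Finset.univ
  simp only [hG, Finset.mem_univ, if_true, Finset.notMem_empty, if_false] at h1
  rw [← h1]
  simp [Fintype.card_perm]

/-- Matrix version of `all_blocks`. -/
theorem all_blocks_det {V K ι : Type} [Fintype V] [DecidableEq V] [Fintype K] [DecidableEq K]
    [Nonempty K] [Fintype ι] [DecidableEq ι] (e : V × K ≃ ι)
    (A : ι → ι → ℚ) (B : V → K → ι → ℚ) :
    ∑ π : V → Perm K, Matrix.det (Matrix.of
        (fun i => A i + B (e.symm i).1 (π (e.symm i).1 (e.symm i).2)))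
      = (Nat.factorial (Fintype.card K) : ℚ) ^ (Fintype.card V) *
        Matrix.det (Matrix.of (fun i => A i + (Fintype.card K : ℚ)⁻¹ • ∑ c, B (e.symm i).1 c)) := by
  have h := all_blocks ((Matrix.detRowAlternating (R := ℚ) (n := ι)).domDomCongr e.symm)
    (fun p => A (e p)) B
  have hd : ∀ F : ι → ι → ℚ, ((Matrix.detRowAlternating (R := ℚ) (n := ι)).domDomCongr e.symm)
      (fun p => F (e p)) = Matrix.det (Matrix.of F) := by
    intro F
    rw [AlternatingMap.domDomCongr_apply]
    simp only [Function.comp_def, Equiv.apply_symm_apply]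
    rfl
  rw [← hd (fun i => A i + (Fintype.card K : ℚ)⁻¹ • ∑ c, B (e.symm i).1 c)]
  simp_rw [← hd]
  simpa using h

/-- The matrix `1 - P_σ + J / N`. -/
def cycMat {ι : Type} [Fintype ι] [DecidableEq ι] (σ : Perm ι) : Matrix ι ι ℚ :=
  Matrix.of (fun i => ((1 : Matrix ι ι ℚ) i + fun _ => (Fintype.card ι : ℚ)⁻¹) +
    - Pi.single (σ i) (1 : ℚ))

theorem cycMat_conj {ι : Type} [Fintype ι] [DecidableEq ι] (σ τ : Perm ι) :
    (cycMat (τ * σ * τ⁻¹)).det = (cycMat σ).det := by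
  rw [← Matrix.det_submatrix_equiv_self τ]
  congr 1
  ext i j
  simp [cycMat, Matrix.one_apply, Pi.single_apply]

theorem cycMat_eq_zero {ι : Type} [Fintype ι] [DecidableEq ι] (σ : Perm ι)
    (h : ¬ ∀ x y, σ.SameCycle x y) : (cycMat σ).det = 0 := by
  classical
  push Not at h
  obtain ⟨x, y, hxy⟩ := h
  rw [← Matrix.exists_mulVec_eq_zero_iff]
  set g : ι → ℚ := fun i => if σ.SameCycle x i then 1 else 0 with hg
  refine ⟨fun i => g i - (Fintype.card ι : ℚ)⁻¹ * ∑ j, g j, ?_, ?_⟩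
  · intro h0
    have hx := congrFun h0 x
    have hy := congrFun h0 y
    simp only [Pi.zero_apply] at hx hy
    have : g x = g y := by linarith
    simp [hg, hxy] at this
    exact this (Perm.SameCycle.refl σ x)
  · have hN : (Fintype.card ι : ℚ) ≠ 0 := by
      have : Nonempty ι := ⟨x⟩
      simp
    funext i
    have hgi : g (σ i) = g i := by simp [hg]
    simp only [cycMat, Matrix.mulVec, dotProduct, Matrix.of_apply, Pi.add_apply, Pi.neg_apply,
      add_mul, neg_mul, Finset.sum_add_distrib, Finset.sum_neg_distrib, Matrix.one_apply,
      Pi.single_apply, ite_mul, one_mul, zero_mul, Finset.sum_ite_eq, Finset.sum_ite_eq',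
      Finset.mem_univ, if_true, ← Finset.mul_sum, Finset.sum_sub_distrib, hgi, Finset.sum_const,
      Finset.card_univ, nsmul_eq_mul, Pi.zero_apply]
    field_simp
    ring

theorem sameCycle_iff_cycleType {ι : Type} [Fintype ι] [DecidableEq ι] [Nontrivial ι]
    (σ : Perm ι) : (∀ x y, σ.SameCycle x y) ↔ σ.cycleType = {Fintype.card ι} := by
  constructor
  · intro h
    have hc : σ.IsCycle := by
      rw [Perm.isCycle_iff_exists_isCycleOn]
      exact ⟨Set.univ, Set.nontrivial_univ, ⟨Set.bijOn_univ.mpr σ.bijective, fun x _ y _ => h x y⟩,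
        fun _ _ => trivial⟩
    rw [hc.cycleType]
    have : σ.support = Finset.univ := by
      ext x
      simp only [Perm.mem_support, Finset.mem_univ, iff_true]
      intro hx
      obtain ⟨y, hy⟩ := exists_ne x
      obtain ⟨i, hi⟩ := h x y
      rw [Perm.zpow_apply_eq_self_of_apply_eq_self hx] at hi
      exact hy hi.symm
    rw [this, Finset.card_univ]
  · intro h x y
    have hc : σ.IsCycle := by
      rw [← Perm.card_cycleType_eq_one, h]; simp
    have hs : σ.support = Finset.univ := by
      rw [← Finset.card_eq_iff_eq_univ, ← Perm.sum_cycleType, h]; simp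
    apply hc.sameCycle <;> rw [← Perm.mem_support, hs] <;> simp

theorem cycMat_eq_card {ι : Type} [Fintype ι] [DecidableEq ι] [Nontrivial ι] (σ : Perm ι)
    (h : ∀ x y, σ.SameCycle x y) : (cycMat σ).det = Fintype.card ι := by
  classical
  set N := Fintype.card ι with hNdef
  have h1 := all_blocks_det (V := Unit) (Equiv.punitProd ι)
    (fun i => ((1 : Matrix ι ι ℚ) i + fun _ => (Fintype.card ι : ℚ)⁻¹))
    (fun _ c => - Pi.single c (1 : ℚ))
  have hE : (Matrix.of (fun i => ((1 : Matrix ι ι ℚ) i + fun _ => (Fintype.card ι : ℚ)⁻¹) +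
      (Fintype.card ι : ℚ)⁻¹ • ∑ c, - Pi.single c (1 : ℚ))) = (1 : Matrix ι ι ℚ) := by
    ext i j
    simp [Finset.sum_apply, Pi.single_apply]
  simp only [hE, Matrix.det_one] at h1
  have h2 : ∑ σ : Perm ι, (cycMat σ).det = N.factorial := by
    rw [← Equiv.sum_comp (Equiv.funUnique Unit (Perm ι))]
    simpa [cycMat] using h1
  have h3 : ∀ τ : Perm ι, (cycMat τ).det = if τ.cycleType = {N} then (cycMat σ).det else 0 := by
    intro τ
    split_ifs with hτ
    · have : IsConj σ τ := by
        rw [Perm.isConj_iff_cycleType_eq, hτ, (sameCycle_iff_cycleType σ).1 h]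
      obtain ⟨c, hc⟩ := isConj_iff.1 this
      rw [← hc, cycMat_conj]
    · exact cycMat_eq_zero τ (fun h' => hτ ((sameCycle_iff_cycleType τ).1 h'))
  rw [Finset.sum_congr rfl fun τ _ => h3 τ, ← Finset.sum_filter, Finset.sum_const,
    Perm.card_of_cycleType_singleton Fintype.one_lt_card le_rfl, Nat.choose_self, mul_one,
    nsmul_eq_mul, ← Nat.mul_factorial_pred (Fintype.card_ne_zero : N ≠ 0)] at h2
  push_cast at h2
  have hf : ((N - 1).factorial : ℚ) ≠ 0 := by exact_mod_cast Nat.factorial_ne_zero _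
  apply mul_left_cancel₀ hf
  rw [h2]; ring

/-- Splitting off the first letter. -/
def consE (k m : ℕ) : (Fin m → Fin k) × Fin k ≃ (Fin (m + 1) → Fin k) where
  toFun p := Fin.cons p.2 p.1
  invFun w := (Fin.tail w, w 0)
  left_inv p := by simp
  right_inv w := by simp

/-- Splitting off the last letter. -/
def snocE (k m : ℕ) : (Fin m → Fin k) × Fin k ≃ (Fin (m + 1) → Fin k) where
  toFun p := Fin.snoc p.1 p.2
  invFun w := (Fin.init w, w (Fin.last m))
  left_inv p := by simp
  right_inv w := by simp

/-- The transition permutation attached to a choice of local permutations. -/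
def transPerm {k m : ℕ} (π : (Fin m → Fin k) → Perm (Fin k)) : Perm (Fin (m + 1) → Fin k) :=
  (consE k m).symm.trans ((Equiv.prodShear (Equiv.refl _) π).trans (snocE k m))

theorem transPerm_apply {k m : ℕ} (π : (Fin m → Fin k) → Perm (Fin k)) (w : Fin (m + 1) → Fin k) :
    transPerm π w = snocE k m (Fin.tail w, π (Fin.tail w) (w 0)) := rfl

/-- The averaged transition matrix. -/
def avgMat (k m : ℕ) : Matrix (Fin (m + 1) → Fin k) (Fin (m + 1) → Fin k) ℚ :=
  Matrix.of fun w => (k : ℚ)⁻¹ • ∑ c, Pi.single (snocE k m (Fin.tail w, c)) (1 : ℚ)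

theorem avgMat_mul {k m : ℕ} (Y : Matrix (Fin (m + 1) → Fin k) (Fin (m + 1) → Fin k) ℚ) (w u) :
    (avgMat k m * Y) w u = (k : ℚ)⁻¹ * ∑ c, Y (snocE k m (Fin.tail w, c)) u := by
  simp only [Matrix.mul_apply, avgMat, Matrix.of_apply, Pi.smul_apply, Finset.sum_apply,
    smul_eq_mul, mul_assoc, Finset.sum_mul, ← Finset.mul_sum]
  congr 1
  rw [Finset.sum_comm]
  refine Finset.sum_congr rfl fun c _ => ?_
  simp [Pi.single_apply]

/-- The uniform matrix. -/
def unifMat (k m : ℕ) : Matrix (Fin (m + 1) → Fin k) (Fin (m + 1) → Fin k) ℚ :=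
  Matrix.of fun _ _ => ((k : ℚ) ^ (m + 1))⁻¹

theorem avg_unif {k m : ℕ} (hk : 0 < k) : avgMat k m * unifMat k m = unifMat k m := by
  ext w u
  rw [avgMat_mul]
  have : (k : ℚ) ≠ 0 := by positivity
  simp [unifMat, this]

theorem unif_avg {k m : ℕ} (hk : 0 < k) : unifMat k m * avgMat k m = unifMat k m := by
  ext w u
  have h0 : (k : ℚ) ≠ 0 := by positivity
  simp only [Matrix.mul_apply, unifMat, Matrix.of_apply, ← Finset.mul_sum]
  have : ∑ i, avgMat k m i u = 1 := by
    rw [← Equiv.sum_comp (consE k m), Fintype.sum_prod_type]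
    have h1 : ∀ v a, avgMat k m (consE k m (v, a)) u =
        (k : ℚ)⁻¹ * ∑ c, Pi.single (M := fun _ => ℚ) (snocE k m (v, c)) (1 : ℚ) u := by
      intro v a
      simp [avgMat, consE]
    simp_rw [h1]
    simp only [Finset.sum_const, Finset.card_univ, Fintype.card_fin, nsmul_eq_mul]
    simp_rw [mul_inv_cancel_left₀ h0]
    rw [← Fintype.sum_prod_type
      (fun p : (Fin m → Fin k) × Fin k => Pi.single (M := fun _ => ℚ) (snocE k m p) (1 : ℚ) u)]
    rw [Equiv.sum_comp (snocE k m) (fun p => Pi.single (M := fun _ => ℚ) p (1 : ℚ) u)]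
    simp [Pi.single_apply]
  rw [this, mul_one]

theorem avg_pow_dep {k m : ℕ} (j : ℕ) : ∀ (w w' u : Fin (m + 1) → Fin k),
    (∀ t : Fin (m + 1), j ≤ t → w t = w' t) →
    (avgMat k m ^ j) w u = (avgMat k m ^ j) w' u := by
  induction j with
  | zero =>
    intro w w' u h
    have : w = w' := funext fun t => h t (Nat.zero_le _)
    rw [this]
  | succ j ih =>
    intro w w' u h
    rw [pow_succ', avgMat_mul, avgMat_mul]
    congr 1
    refine Finset.sum_congr rfl fun c _ => ih _ _ _ fun t ht => ?_
    induction t using Fin.lastCases with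
    | last => simp [snocE]
    | cast t =>
      simp only [snocE, Equiv.coe_fn_mk, Fin.snoc_castSucc, Fin.tail]
      apply h
      simpa using ht

theorem avg_pow_eq {k m : ℕ} (hk : 0 < k) : avgMat k m ^ (m + 1) = unifMat k m := by
  have hc : ∀ w w' u, (avgMat k m ^ (m + 1)) w u = (avgMat k m ^ (m + 1)) w' u := fun w w' u =>
    avg_pow_dep (m + 1) w w' u fun t ht => absurd t.2 (by omega)
  have hu : ∀ j, unifMat k m * avgMat k m ^ j = unifMat k m := by
    intro j
    induction j with
    | zero => simp
    | succ j ih => rw [pow_succ, ← mul_assoc, ih, unif_avg hk]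
  ext w u
  have h1 := congrFun (congrFun (hu (m + 1)) w) u
  rw [← h1, Matrix.mul_apply]
  simp_rw [fun i => hc i w u]
  have h0 : (k : ℚ) ≠ 0 := by positivity
  simp [unifMat, h0]

theorem avg_nilp {k m : ℕ} (hk : 0 < k) : IsNilpotent (avgMat k m - unifMat k m) := by
  have hp : ∀ j, avgMat k m ^ j * unifMat k m = unifMat k m := by
    intro j
    induction j with
    | zero => simp
    | succ j ih => rw [pow_succ, mul_assoc, avg_unif hk, ih]
  have huu : unifMat k m * unifMat k m = unifMat k m := by
    have := hp (m + 1)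
    rwa [avg_pow_eq hk] at this
  have h : ∀ j, (avgMat k m - unifMat k m) ^ (j + 1) = avgMat k m ^ (j + 1) - unifMat k m := by
    intro j
    induction j with
    | zero => simp
    | succ j ih =>
      rw [pow_succ, ih, mul_sub, sub_mul, sub_mul, hp, unif_avg hk, huu, ← pow_succ]
      abel
  exact ⟨m + 1, by rw [h, avg_pow_eq hk, sub_self]⟩

theorem det_one_sub_nilp {ι : Type} [Fintype ι] [DecidableEq ι] (M : Matrix ι ι ℚ)
    (h : IsNilpotent M) : (1 - M).det = 1 := by
  have h1 := (Matrix.isNilpotent_charpoly_sub_pow_of_isNilpotent h).eq_zero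
  have h2 := congrArg (Polynomial.eval 1) (sub_eq_zero.1 h1)
  rw [Matrix.eval_charpoly] at h2
  simpa using h2

open Classical in
theorem count_transPerm {k m : ℕ} (hk : 2 ≤ k) :
    Nat.card {π : (Fin m → Fin k) → Perm (Fin k) // ∀ x y, (transPerm π).SameCycle x y} *
      k ^ (m + 1) = (Nat.factorial k) ^ (k ^ m) := by
  have : Nonempty (Fin k) := ⟨⟨0, by omega⟩⟩
  have : Nontrivial (Fin k) := Fin.nontrivial_iff_two_le.2 hk
  have h1 := all_blocks_det (consE k m)
    (fun i => ((1 : Matrix (Fin (m + 1) → Fin k) (Fin (m + 1) → Fin k) ℚ) i +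
      fun _ => (Fintype.card (Fin (m + 1) → Fin k) : ℚ)⁻¹))
    (fun v c => - Pi.single (snocE k m (v, c)) (1 : ℚ))
  have hR : (Matrix.of fun i => ((1 : Matrix (Fin (m + 1) → Fin k) (Fin (m + 1) → Fin k) ℚ) i +
      fun _ => (Fintype.card (Fin (m + 1) → Fin k) : ℚ)⁻¹) + (Fintype.card (Fin k) : ℚ)⁻¹ •
      ∑ c, - Pi.single (snocE k m (((consE k m).symm i).1, c)) (1 : ℚ)) =
      1 - (avgMat k m - unifMat k m) := by
    ext i j
    simp [avgMat, unifMat, consE, Finset.sum_apply]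
    ring
  rw [hR, det_one_sub_nilp _ (avg_nilp (by omega)), mul_one] at h1
  have hL : ∀ π : (Fin m → Fin k) → Perm (Fin k), (Matrix.of fun i =>
      ((1 : Matrix (Fin (m + 1) → Fin k) (Fin (m + 1) → Fin k) ℚ) i +
      fun _ => (Fintype.card (Fin (m + 1) → Fin k) : ℚ)⁻¹) +
      - Pi.single (snocE k m (((consE k m).symm i).1,
        π ((consE k m).symm i).1 ((consE k m).symm i).2)) (1 : ℚ)).det =
      if ∀ x y, (transPerm π).SameCycle x y then (k : ℚ) ^ (m + 1) else 0 := by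
    intro π
    change (cycMat (transPerm π)).det = _
    split_ifs with h
    · rw [cycMat_eq_card _ h]; simp
    · exact cycMat_eq_zero _ h
  rw [Finset.sum_congr rfl fun π _ => hL π, ← Finset.sum_filter, Finset.sum_const,
    nsmul_eq_mul] at h1
  rw [Nat.card_eq_fintype_card, Fintype.card_subtype]
  simp only [Fintype.card_fin, Fintype.card_pi, Finset.prod_const, Finset.card_univ] at h1
  exact_mod_cast h1

/-- Valid transition permutations are exactly the `transPerm π`. -/
theorem count_valid {k m : ℕ} :
    Nat.card {π : (Fin m → Fin k) → Perm (Fin k) // ∀ x y, (transPerm π).SameCycle x y} =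
    Nat.card {σ : Perm (Fin (m + 1) → Fin k) // (∀ w, Fin.init (σ w) = Fin.tail w) ∧
      ∀ x y, σ.SameCycle x y} := by
  refine Nat.card_eq_of_bijective
    (fun π => ⟨transPerm π.1, fun w => by simp [transPerm_apply, snocE], π.2⟩) ⟨?_, ?_⟩
  · rintro ⟨π, h⟩ ⟨π', h'⟩ hh
    have hh := congrArg Subtype.val hh
    simp only at hh
    apply Subtype.ext
    funext v
    ext1 a
    have := congrArg (fun τ : Perm _ => τ (consE k m (v, a)) (Fin.last m)) hh
    simpa [transPerm_apply, snocE, consE] using this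
  · rintro ⟨σ, hv, hs⟩
    have hinj : ∀ v, Function.Injective (fun a => σ (consE k m (v, a)) (Fin.last m)) := by
      intro v a a' haa
      have h1 : σ (consE k m (v, a)) = σ (consE k m (v, a')) := by
        apply (snocE k m).symm.injective
        refine Prod.ext ?_ haa
        refine (hv _).trans (Eq.trans ?_ (hv _).symm)
        simp [consE]
      have := (consE k m).injective (σ.injective h1)
      simpa using this
    let π : (Fin m → Fin k) → Perm (Fin k) := fun v =>
      Equiv.ofBijective _ (Finite.injective_iff_bijective.1 (hinj v))
    have hπ : transPerm π = σ := by
      ext1 w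
      rw [transPerm_apply]
      apply (snocE k m).symm.injective
      rw [Equiv.symm_apply_apply]
      refine Prod.ext (hv w).symm ?_
      change σ (consE k m ((consE k m).symm w)) (Fin.last m) = σ w (Fin.last m)
      rw [Equiv.apply_symm_apply]
    exact ⟨⟨π, by rw [hπ]; exact hs⟩, Subtype.ext hπ⟩

/-- The window map. -/
def win (k n : ℕ) (w : ZMod (k ^ n) → Fin k) (i : ZMod (k ^ n)) : Fin n → Fin k :=
  fun t => w (i + (t : ℕ))

/-- The rotation class. -/
def rotClass (k n : ℕ) (w : ZMod (k ^ n) → Fin k) : Set (ZMod (k ^ n) → Fin k) :=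
  {w' | ∃ t : ZMod (k ^ n), ∀ i, w' i = w (i + t)}

theorem win_rel_unique {k n : ℕ} (w : ZMod (k ^ n) → Fin k) (hw : IsDeBruijnSeq k n w)
    (σ σ' : Perm (Fin n → Fin k)) (h : ∀ i, σ (win k n w i) = win k n w (i + 1))
    (h' : ∀ i, σ' (win k n w i) = win k n w (i + 1)) : σ = σ' := by
  ext1 x
  obtain ⟨i, rfl⟩ := hw.2 x
  exact (h i).trans (h' i).symm

theorem win_rel_exists {k m : ℕ} (w : ZMod (k ^ (m + 1)) → Fin k)
    (hw : IsDeBruijnSeq k (m + 1) w) :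
    ∃ σ : Perm (Fin (m + 1) → Fin k), ((∀ x, Fin.init (σ x) = Fin.tail x) ∧
      ∀ x y, σ.SameCycle x y) ∧ ∀ i, σ (win k (m + 1) w i) = win k (m + 1) w (i + 1) := by
  let Φ : ZMod (k ^ (m + 1)) ≃ (Fin (m + 1) → Fin k) := Equiv.ofBijective (win k (m + 1) w) hw
  have hΦ : ∀ i, Φ i = win k (m + 1) w i := fun _ => rfl
  let σ : Perm (Fin (m + 1) → Fin k) := Φ.symm.trans ((Equiv.addRight 1).trans Φ)
  have hσ : ∀ i, σ (Φ i) = Φ (i + 1) := fun i => by simp [σ]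
  refine ⟨σ, ⟨?_, ?_⟩, hσ⟩
  · intro x
    obtain ⟨i, rfl⟩ := Φ.surjective x
    rw [hσ, hΦ, hΦ]
    funext t
    simp only [Fin.init, Fin.tail, win]
    congr 1
    simp
    ring
  · have hpow : ∀ (j : ℕ) i, (σ ^ j) (Φ i) = Φ (i + j) := by
      intro j
      induction j with
      | zero => simp
      | succ j ih =>
        intro i
        rw [pow_succ', Perm.mul_apply, ih, hσ]
        congr 1
        push_cast
        ring
    intro x y
    obtain ⟨i, rfl⟩ := Φ.surjective x
    obtain ⟨j, rfl⟩ := Φ.surjective y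
    obtain ⟨z, hz⟩ := ZMod.intCast_surjective (j - i)
    have hzp : ∀ (z : ℤ) i, (σ ^ z) (Φ i) = Φ (i + z) := by
      intro z i
      obtain ⟨a, rfl | rfl⟩ := z.eq_nat_or_neg
      · simpa using hpow a i
      · rw [zpow_neg, Perm.inv_eq_iff_eq, zpow_natCast, hpow]
        simp
    exact ⟨z, by rw [hzp, hz]; simp⟩

theorem rotClass_eq_of_mem {k n : ℕ} (w w' : ZMod (k ^ n) → Fin k) (t : ZMod (k ^ n))
    (h : ∀ i, w' i = w (i + t)) : rotClass k n w' = rotClass k n w := by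
  ext u
  constructor
  · rintro ⟨s, hs⟩
    exact ⟨s + t, fun i => by rw [hs, h, add_assoc]⟩
  · rintro ⟨s, hs⟩
    exact ⟨s - t, fun i => by rw [hs, h]; congr 1; ring⟩

theorem rot_of_rel {k m : ℕ} (hk : 0 < k) (w w' : ZMod (k ^ (m + 1)) → Fin k)
    (hw : IsDeBruijnSeq k (m + 1) w) (σ : Perm (Fin (m + 1) → Fin k))
    (h : ∀ i, σ (win k (m + 1) w i) = win k (m + 1) w (i + 1))
    (h' : ∀ i, σ (win k (m + 1) w' i) = win k (m + 1) w' (i + 1)) :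
    rotClass k (m + 1) w' = rotClass k (m + 1) w := by
  obtain ⟨t, ht⟩ := hw.2 (win k (m + 1) w' 0)
  have ht : win k (m + 1) w t = win k (m + 1) w' 0 := ht
  have hj : ∀ j : ℕ, win k (m + 1) w' j = win k (m + 1) w (j + t) := by
    intro j
    induction j with
    | zero => simp [ht]
    | succ j ih =>
      push_cast
      rw [← h', ih, h]
      congr 1
      ring
  have : NeZero (k ^ (m + 1)) := ⟨by positivity⟩
  refine rotClass_eq_of_mem w w' t fun i => ?_
  obtain ⟨j, rfl⟩ := ZMod.natCast_zmod_surjective i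
  have := congrFun (hj j) 0
  simpa [win] using this

theorem rel_of_rot {k n : ℕ} (w w' : ZMod (k ^ n) → Fin k) (t : ZMod (k ^ n))
    (ht : ∀ i, w' i = w (i + t)) (σ : Perm (Fin n → Fin k))
    (h : ∀ i, σ (win k n w i) = win k n w (i + 1)) :
    ∀ i, σ (win k n w' i) = win k n w' (i + 1) := by
  have e : ∀ i, win k n w' i = win k n w (i + t) := by
    intro i
    funext s
    simp only [win, ht]
    congr 1
    ring
  intro i
  rw [e, e, h]
  congr 1
  ring

theorem exists_seq {k m : ℕ} (hk : 0 < k) (σ : Perm (Fin (m + 1) → Fin k))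
    (hv : ∀ x, Fin.init (σ x) = Fin.tail x) (hs : ∀ x y, σ.SameCycle x y) :
    ∃ w, IsDeBruijnSeq k (m + 1) w ∧ ∀ i, σ (win k (m + 1) w i) = win k (m + 1) w (i + 1) := by
  have : NeZero (k ^ (m + 1)) := ⟨by positivity⟩
  have hc : σ.IsCycleOn ((Finset.univ : Finset (Fin (m + 1) → Fin k)) : Set _) := by
    rw [Finset.coe_univ]
    exact ⟨Set.bijOn_univ.mpr σ.bijective, fun x _ y _ => hs x y⟩
  have hcard : (Finset.univ : Finset (Fin (m + 1) → Fin k)).card = k ^ (m + 1) := by simp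
  let x0 : Fin (m + 1) → Fin k := fun _ => ⟨0, hk⟩
  let Ψ : ZMod (k ^ (m + 1)) → (Fin (m + 1) → Fin k) := fun i => (σ ^ i.val) x0
  have hΨ : ∀ j : ℕ, Ψ j = (σ ^ j) x0 := by
    intro j
    simp only [Ψ]
    rw [hc.pow_apply_eq_pow_apply (Finset.mem_univ _), hcard, ZMod.val_natCast]
    exact Nat.mod_modEq _ _
  have hstep : ∀ i, σ (Ψ i) = Ψ (i + 1) := by
    intro i
    obtain ⟨j, rfl⟩ := ZMod.natCast_zmod_surjective i
    have := hΨ (j + 1)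
    rw [Nat.cast_add, Nat.cast_one] at this
    rw [this, hΨ, pow_succ', Perm.mul_apply]
  have hletter : ∀ (t : ℕ) (ht : t < m + 1) i, Ψ (i + t) 0 = Ψ i ⟨t, ht⟩ := by
    intro t
    induction t with
    | zero => intro ht i; simp
    | succ t ih =>
      intro ht i
      have h1 := ih (by omega) (i + 1)
      have h2 := congrFun (hv (Ψ i)) ⟨t, by omega⟩
      rw [hstep] at h2
      have h3 : i + ((t + 1 : ℕ) : ZMod (k ^ (m + 1))) = i + 1 + t := by push_cast; ring
      rw [h3, h1]
      exact h2
  have hwin : win k (m + 1) (fun i => Ψ i 0) = Ψ := by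
    funext i t
    exact hletter t t.2 i
  refine ⟨fun i => Ψ i 0, ?_, ?_⟩
  · change Function.Bijective (win k (m + 1) (fun i => Ψ i 0))
    rw [hwin, Fintype.bijective_iff_surjective_and_card]
    refine ⟨fun y => ?_, by simp [ZMod.card]⟩
    obtain ⟨j, _, hj⟩ := hc.exists_pow_eq (Finset.mem_univ x0) (Finset.mem_univ y)
    exact ⟨j, by rw [hΨ, hj]⟩
  · rw [hwin]; exact hstep

theorem count_classes {k m : ℕ} (hk : 0 < k) :
    Nat.card {S : Set (ZMod (k ^ (m + 1)) → Fin k) //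
      ∃ w, IsDeBruijnSeq k (m + 1) w ∧ S = rotClass k (m + 1) w} =
    Nat.card {σ : Perm (Fin (m + 1) → Fin k) // (∀ w, Fin.init (σ w) = Fin.tail w) ∧
      ∀ x y, σ.SameCycle x y} := by
  have hself : ∀ w, w ∈ rotClass k (m + 1) w := fun w => ⟨0, fun i => by simp⟩
  symm
  choose W hW hrel using fun σ : {σ : Perm (Fin (m + 1) → Fin k) //
    (∀ w, Fin.init (σ w) = Fin.tail w) ∧ ∀ x y, σ.SameCycle x y} =>
      exists_seq hk σ.1 σ.2.1 σ.2.2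
  refine Nat.card_eq_of_bijective (fun σ => ⟨rotClass k (m + 1) (W σ), W σ, hW σ, rfl⟩) ⟨?_, ?_⟩
  · intro σ σ' h
    have h : rotClass k (m + 1) (W σ) = rotClass k (m + 1) (W σ') := congrArg Subtype.val h
    have hm := hself (W σ')
    rw [← h] at hm
    obtain ⟨t, ht⟩ := hm
    exact Subtype.ext (win_rel_unique (W σ') (hW σ') _ _
      (rel_of_rot (W σ) (W σ') t ht σ.1 (hrel σ)) (hrel σ'))
  · rintro ⟨S, w, hw, rfl⟩
    obtain ⟨σ, hσ, hr⟩ := win_rel_exists w hw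
    exact ⟨⟨σ, hσ⟩, Subtype.ext (rot_of_rel hk w (W ⟨σ, hσ⟩) hw σ hr (hrel ⟨σ, hσ⟩))⟩

/-- The number of cyclic `(k,n)`-de Bruijn sequences (i.e. rotation classes of
de Bruijn sequences) is `k!^(k^(n-1)) / k^n`. -/
theorem stmt_0 (k n : ℕ) (hk : 2 ≤ k) (hn : 2 ≤ n) :
    Nat.card {S : Set (ZMod (k ^ n) → Fin k) //
      ∃ w, IsDeBruijnSeq k n w ∧ S = {w' | ∃ t : ZMod (k ^ n), ∀ i, w' i = w (i + t)}} =
      (Nat.factorial k) ^ (k ^ (n - 1)) / k ^ n := by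
  obtain ⟨m, rfl⟩ : ∃ m, n = m + 1 := ⟨n - 1, by omega⟩
  have h := count_transPerm (m := m) hk
  rw [count_valid, ← count_classes (by omega)] at h
  rw [Nat.add_sub_cancel, ← h, Nat.mul_div_cancel _ (by positivity)]
  rfl
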